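/- Let n ≥ 1 be an integer and ξ a transcendental real number. Then ŵ*_n(ξ) ≤ n + (n-1)·ŵ*_n(ξ)/w_n(ξ). -/

import Mathlib

open Polynomial Filter

/-- Height of an integer polynomial: the maximum absolute value of its coefficients. -/
noncomputable def polyHeight (P : Polynomial ℤ) : ℝ :=
  ((P.support.sup fun i => (P.coeff i).natAbs : ℕ) : ℝ)

/-- `P` and `Q` have no common non-constant factor in `ℤ[X]`. -/
def CoprimePoly (P Q : Polynomial ℤ) : Prop :=
  ∀ d : Polynomial ℤ, d ∣ P → d ∣ Q → d.natDegree = 0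

/-- The exponent `w_n(ξ)`. -/
noncomputable def wExp (n : ℕ) (ξ : ℝ) : EReal :=
  sSup {x : EReal | ∃ w : ℝ, x = (w : EReal) ∧
    {P : Polynomial ℤ | P.natDegree ≤ n ∧ 0 < |Polynomial.aeval ξ P| ∧
      |Polynomial.aeval ξ P| ≤ (polyHeight P) ^ (-w)}.Infinite}

/-- The uniform exponent `ŵ_n(ξ)`. -/
noncomputable def whExp (n : ℕ) (ξ : ℝ) : EReal :=
  sSup {x : EReal | ∃ w : ℝ, x = (w : EReal) ∧
    ∀ᶠ H : ℝ in atTop, ∃ P : Polynomial ℤ, P.natDegree ≤ n ∧ polyHeight P ≤ H ∧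
      0 < |Polynomial.aeval ξ P| ∧ |Polynomial.aeval ξ P| ≤ H ^ (-w)}

/-- The exponent `w*_n(ξ)` of approximation by algebraic numbers of degree at most `n`;
the height of an algebraic number is the height of its irreducible defining polynomial. -/
noncomputable def wStarExp (n : ℕ) (ξ : ℝ) : EReal :=
  sSup {x : EReal | ∃ w : ℝ, x = (w : EReal) ∧
    {α : ℝ | ∃ P : Polynomial ℤ, Irreducible P ∧ Polynomial.aeval α P = 0 ∧
      P.natDegree ≤ n ∧ 0 < |ξ - α| ∧ |ξ - α| ≤ (polyHeight P) ^ (-w - 1)}.Infinite}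

/-- The uniform exponent `ŵ*_n(ξ)`. -/
noncomputable def whStarExp (n : ℕ) (ξ : ℝ) : EReal :=
  sSup {x : EReal | ∃ w : ℝ, x = (w : EReal) ∧
    ∀ᶠ H : ℝ in atTop, ∃ α : ℝ, ∃ P : Polynomial ℤ, Irreducible P ∧
      Polynomial.aeval α P = 0 ∧ P.natDegree ≤ n ∧ polyHeight P ≤ H ∧
      0 < |ξ - α| ∧ |ξ - α| ≤ (polyHeight P)⁻¹ * H ^ (-w)}

lemma abs_coeff_le_polyHeight (P : ℤ[X]) (i : ℕ) : |(P.coeff i : ℝ)| ≤ polyHeight P := by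
  by_cases h : i ∈ P.support
  · have := Finset.le_sup (f := fun i => (P.coeff i).natAbs) h
    rw [polyHeight, ← Int.cast_abs, Int.abs_eq_natAbs]
    exact_mod_cast this
  · rw [notMem_support_iff.mp h]
    simp [polyHeight]

lemma polyHeight_le {P : ℤ[X]} {B : ℝ} (hB : 0 ≤ B) (h : ∀ i, |(P.coeff i : ℝ)| ≤ B) :
    polyHeight P ≤ B := by
  rw [polyHeight, ← Nat.le_floor_iff hB]
  refine Finset.sup_le fun i _ => Nat.le_floor ?_
  rw [Nat.cast_natAbs, Int.cast_abs]
  exact h i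

lemma one_le_polyHeight {P : ℤ[X]} (hP : P ≠ 0) : 1 ≤ polyHeight P := by
  refine le_trans ?_ (abs_coeff_le_polyHeight P P.natDegree)
  have := Int.one_le_abs (leadingCoeff_ne_zero.mpr hP)
  exact_mod_cast this

lemma mahlerMeasure_le_mul_polyHeight {P : ℤ[X]} {n : ℕ} (hn : P.natDegree ≤ n) :
    (P.map (Int.castRingHom ℂ)).mahlerMeasure ≤ (n + 1) * polyHeight P := by
  refine (mahlerMeasure_le_sum_norm_coeff _).trans ?_
  rw [sum_over_range' _ (by simp) (n + 1)
    (Nat.lt_succ_of_le (natDegree_map_le.trans hn))]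
  refine (Finset.sum_le_card_nsmul _ _ (polyHeight P) fun i _ => ?_).trans (by simp)
  simpa using abs_coeff_le_polyHeight P i

lemma polyHeight_le_mul_mahlerMeasure {P : ℤ[X]} {n : ℕ} (hn : P.natDegree ≤ n) :
    polyHeight P ≤ 2 ^ n * (P.map (Int.castRingHom ℂ)).mahlerMeasure := by
  refine polyHeight_le (mul_nonneg (by positivity) (mahlerMeasure_nonneg _)) fun i => ?_
  have h := norm_coeff_le_choose_mul_mahlerMeasure i (P.map (Int.castRingHom ℂ))
  rw [coeff_map, eq_intCast, Complex.norm_intCast] at h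
  refine h.trans ?_
  gcongr
  · exact mahlerMeasure_nonneg _
  · have h1 : ((P.map (Int.castRingHom ℂ)).natDegree.choose i) ≤ 2 ^ n :=
      (Nat.choose_le_two_pow _ _).trans
        (Nat.pow_le_pow_right two_pos (natDegree_map_le.trans hn))
    exact_mod_cast h1

lemma finite_polyHeight_le (n : ℕ) (B : ℝ) :
    {P : ℤ[X] | P.natDegree ≤ n ∧ polyHeight P ≤ B}.Finite := by
  refine (finite_mahlerMeasure_le n ((n + 1) * B).toNNReal).subset fun P hP => ⟨hP.1, ?_⟩
  refine (mahlerMeasure_le_mul_polyHeight hP.1).trans ?_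
  refine le_trans ?_ (Real.le_coe_toNNReal _)
  gcongr
  exact hP.2

lemma aeval_ne_zero_of_transcendental {ξ : ℝ} (hξ : Transcendental ℚ ξ) {P : ℤ[X]} (hP : P ≠ 0) :
    aeval ξ P ≠ 0 := by
  intro h
  refine hξ ⟨P.map (Int.castRingHom ℚ), ?_, ?_⟩
  · rwa [Ne, Polynomial.map_eq_zero_iff Int.cast_injective]
  · rw [← h, ← algebraMap_int_eq, aeval_map_algebraMap]

lemma one_le_abs_aeval_of_natDegree_eq_zero (ξ : ℝ) {P : ℤ[X]} (hP : P ≠ 0)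
    (h : P.natDegree = 0) : 1 ≤ |aeval ξ P| := by
  obtain ⟨a, rfl⟩ := natDegree_eq_zero.mp h
  have ha : a ≠ 0 := by simpa using hP
  have := Int.one_le_abs ha
  rw [aeval_C, eq_intCast]
  exact_mod_cast this

/-- A lower bound for irreducible polynomials in terms of the Mahler measure propagates to
products. -/
lemma le_abs_aeval_of_irreducible {n : ℕ} {ξ w δ : ℝ} (hw : 0 ≤ w) (hδ : 0 < δ) (hδ1 : δ ≤ 1)
    (h : ∀ P : ℤ[X], Irreducible P → P.natDegree ≤ n →
      δ * (P.map (Int.castRingHom ℂ)).mahlerMeasure ^ (-w) ≤ |aeval ξ P|)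
    (P : ℤ[X]) (hP : P ≠ 0) (hPn : P.natDegree ≤ n) :
    δ ^ P.natDegree * (P.map (Int.castRingHom ℂ)).mahlerMeasure ^ (-w) ≤ |aeval ξ P| := by
  have hconst : ∀ P : ℤ[X], P ≠ 0 → P.natDegree = 0 →
      δ ^ P.natDegree * (P.map (Int.castRingHom ℂ)).mahlerMeasure ^ (-w) ≤ |aeval ξ P| := by
    intro P hP h0
    refine le_trans ?_ (one_le_abs_aeval_of_natDegree_eq_zero ξ hP h0)
    rw [h0, pow_zero, one_mul]
    exact Real.rpow_le_one_of_one_le_of_nonpos (one_le_mahlerMeasure_of_ne_zero hP) (by linarith)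
  induction P using WfDvdMonoid.induction_on_irreducible with
  | zero => exact absurd rfl hP
  | unit u hu => exact hconst u hP (natDegree_eq_zero_of_isUnit hu)
  | mul a i ha hi ih =>
    rw [natDegree_mul hi.ne_zero ha] at hPn ⊢
    have h1 := ih ha (by omega)
    have h2 : δ ^ i.natDegree * (i.map (Int.castRingHom ℂ)).mahlerMeasure ^ (-w)
        ≤ |aeval ξ i| := by
      rcases Nat.eq_zero_or_pos i.natDegree with h0 | h0
      · exact hconst i hi.ne_zero h0
      · refine le_trans ?_ (h i hi (by omega))
        gcongr
        · exact Real.rpow_nonneg (mahlerMeasure_nonneg _) _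
        · exact pow_le_of_le_one hδ.le hδ1 h0.ne'
    rw [Polynomial.map_mul, mahlerMeasure_mul, map_mul, abs_mul,
      Real.mul_rpow (mahlerMeasure_nonneg _) (mahlerMeasure_nonneg _), pow_add, mul_mul_mul_comm]
    exact mul_le_mul h2 h1 (mul_nonneg (by positivity)
      (Real.rpow_nonneg (mahlerMeasure_nonneg _) _)) (abs_nonneg _)

/-- Below the exponent `w_n(ξ)`, irreducible polynomials are arbitrarily small at `ξ`. -/
lemma exists_irreducible_abs_aeval_lt {n : ℕ} {ξ w : ℝ} (hw : 0 ≤ w)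
    (hwn : (w : EReal) < wExp n ξ) {δ : ℝ} (hδ : 0 < δ) :
    ∃ P : ℤ[X], Irreducible P ∧ P.natDegree ≤ n ∧ |aeval ξ P| < δ * polyHeight P ^ (-w) := by
  by_contra! hcon
  obtain ⟨_, ⟨w', rfl, hinf⟩, hww'⟩ := lt_sSup_iff.mp hwn
  rw [EReal.coe_lt_coe_iff] at hww'
  set ε : ℝ := min δ 1 * (2 ^ n : ℝ) ^ (-w) with hε
  have hε0 : 0 < ε := by positivity
  have hε1 : ε ≤ 1 := mul_le_one₀ (min_le_right _ _) (by positivity)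
    (Real.rpow_le_one_of_one_le_of_nonpos (one_le_pow₀ one_le_two) (by linarith))
  have hlow := le_abs_aeval_of_irreducible (n := n) (ξ := ξ) hw hε0 hε1 fun P hP hPn => by
    refine le_trans ?_ (hcon P hP hPn)
    rw [hε, mul_assoc, ← Real.mul_rpow (by positivity) (mahlerMeasure_nonneg _)]
    refine mul_le_mul (min_le_left _ _) ?_
      (Real.rpow_nonneg (mul_nonneg (by positivity) (mahlerMeasure_nonneg _)) _) hδ.le
    exact Real.rpow_le_rpow_of_nonpos (by linarith [one_le_polyHeight hP.ne_zero])
      (polyHeight_le_mul_mahlerMeasure hPn) (by linarith)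
  set c : ℝ := ε ^ n * (n + 1 : ℝ) ^ (-w) with hc
  have hc0 : 0 < c := by positivity
  refine hinf ((finite_polyHeight_le n ((1 / c) ^ (w' - w)⁻¹)).subset ?_)
  rintro P ⟨hPn, hP0, hPw⟩
  refine ⟨hPn, ?_⟩
  have hP : P ≠ 0 := by rintro rfl; simp at hP0
  have hH := one_le_polyHeight hP
  have hH0 : 0 < polyHeight P := by linarith
  have key : c * polyHeight P ^ (-w) ≤ polyHeight P ^ (-w') := by
    refine le_trans ?_ ((hlow P hP hPn).trans hPw)
    rw [hc, mul_assoc, ← Real.mul_rpow (by positivity) hH0.le]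
    refine mul_le_mul (pow_le_pow_of_le_one hε0.le hε1 hPn) ?_ (by positivity) (by positivity)
    exact Real.rpow_le_rpow_of_nonpos
      (by linarith [one_le_mahlerMeasure_of_ne_zero hP])
      (mahlerMeasure_le_mul_polyHeight hPn) (by linarith)
  rw [Real.le_rpow_inv_iff_of_pos hH0.le (by positivity) (by linarith), le_div_iff₀ hc0,
    Real.rpow_sub hH0, div_mul_eq_mul_div, div_le_one (by positivity)]
  rw [Real.rpow_neg hH0.le, Real.rpow_neg hH0.le, ← div_eq_mul_inv, div_le_iff₀ (by positivity),
    inv_mul_eq_div, le_div_iff₀ (by positivity)] at key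
  linarith

lemma abs_aeval_le_of_root {n : ℕ} {ξ α : ℝ} {Q : ℤ[X]} (hα : aeval α Q = 0)
    (hQn : Q.natDegree ≤ n) (h : |ξ - α| ≤ 1) :
    |aeval ξ Q| ≤ (n + 1) * (n * (|ξ| + 1) ^ n) * (polyHeight Q * |ξ - α|) := by
  have hsum : aeval ξ Q = ∑ k ∈ Finset.range (n + 1), (Q.coeff k : ℝ) * (ξ ^ k - α ^ k) := by
    rw [← sub_zero (aeval ξ Q), ← hα, aeval_eq_sum_range' (Nat.lt_succ_of_le hQn),
      aeval_eq_sum_range' (Nat.lt_succ_of_le hQn), ← Finset.sum_sub_distrib]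
    refine Finset.sum_congr rfl fun k _ => ?_
    simp only [zsmul_eq_mul]
    ring
  have hαξ : |α| ≤ |ξ| + 1 := by
    have := abs_sub_abs_le_abs_sub α ξ
    rw [abs_sub_comm] at this
    linarith
  rw [hsum]
  refine (Finset.abs_sum_le_sum_abs _ _).trans ?_
  refine (Finset.sum_le_card_nsmul _ _ (n * (|ξ| + 1) ^ n * (polyHeight Q * |ξ - α|))
    fun k hk => ?_).trans (by simp [mul_assoc])
  have hkn : k ≤ n := Nat.lt_succ_iff.mp (Finset.mem_range.mp hk)
  rw [abs_mul]
  have h1 : |ξ ^ k - α ^ k| ≤ |ξ - α| * (n * (|ξ| + 1) ^ n) := by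
    refine (abs_pow_sub_pow_le _ _ _).trans ?_
    rw [mul_assoc]
    gcongr
    calc max |ξ| |α| ^ (k - 1) ≤ (|ξ| + 1) ^ (k - 1) := by
          gcongr
          exact max_le (by linarith) hαξ
      _ ≤ (|ξ| + 1) ^ n := pow_le_pow_right₀ (by linarith [abs_nonneg ξ]) (by omega)
  calc |(Q.coeff k : ℝ)| * |ξ ^ k - α ^ k|
      ≤ polyHeight Q * (|ξ - α| * (n * (|ξ| + 1) ^ n)) := by
        gcongr
        · exact (abs_nonneg _).trans (abs_coeff_le_polyHeight Q 0)
        · exact abs_coeff_le_polyHeight Q k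
    _ = _ := by ring

/-- Leibniz bound for a determinant whose columns are bounded by `h`, with an extra factor `t` in
one row. -/
lemma abs_det_le_of_row_small {N : ℕ} (A : Matrix (Fin N) (Fin N) ℝ) (r : Fin N) (h : Fin N → ℝ)
    (t : ℝ) (hA : ∀ i j, i ≠ r → |A i j| ≤ h j) (hr : ∀ j, |A r j| ≤ h j * t) :
    |A.det| ≤ N.factorial * ((∏ j, h j) * t) := by
  rw [Matrix.det_apply]
  refine (Finset.abs_sum_le_sum_abs _ _).trans ?_
  refine (Finset.sum_le_card_nsmul _ _ ((∏ j, h j) * t) fun σ _ => ?_).trans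
    (by simp [Fintype.card_perm])
  have habs : |Equiv.Perm.sign σ • ∏ i, A (σ i) i| = ∏ i, |A (σ i) i| := by
    rw [← Finset.abs_prod]
    rcases Int.units_eq_one_or (Equiv.Perm.sign σ) with hs | hs <;> simp [hs]
  rw [habs]
  calc ∏ i, |A (σ i) i| ≤ ∏ i, (h i * if i = σ⁻¹ r then t else 1) := by
        refine Finset.prod_le_prod (fun i _ => abs_nonneg _) fun i _ => ?_
        split_ifs with hi
        · rw [hi, Equiv.Perm.coe_inv, Equiv.apply_symm_apply]
          exact hr _
        · rw [mul_one]
          exact hA _ _ fun hi' => hi (by rw [← hi', Equiv.Perm.coe_inv, Equiv.symm_apply_apply])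
    _ = _ := by rw [Finset.prod_mul_distrib, Finset.prod_ite_eq' Finset.univ]; simp

lemma sum_pow_mul_shift_coeff (f : ℤ[X]) (x : ℝ) {n j N : ℕ} (hf : f.natDegree ≤ n)
    (hN : j + n < N) :
    ∑ i : Fin N, x ^ (i : ℕ) *
      ((if (i : ℕ) ∈ Set.Icc j (j + n) then f.coeff (i - j) else 0 : ℤ) : ℝ) =
      x ^ j * aeval x f := by
  rw [Fin.sum_univ_eq_sum_range (fun i => x ^ i *
    ((if i ∈ Set.Icc j (j + n) then f.coeff (i - j) else 0 : ℤ) : ℝ)) N,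
    aeval_eq_sum_range' (Nat.lt_succ_of_le hf), Finset.mul_sum]
  symm
  refine Finset.sum_of_injOn (fun k => j + k) (fun a _ b _ h => by simpa using h) ?_ ?_ ?_
  · intro k hk
    simp only [Finset.coe_range, Set.mem_Iio] at hk ⊢
    omega
  · intro i _ hi
    rw [if_neg, Int.cast_zero, mul_zero]
    rintro ⟨h1, h2⟩
    exact hi ⟨i - j, by simp only [Finset.coe_range, Set.mem_Iio]; omega, by simp only; omega⟩
  · intro k hk
    rw [Finset.mem_range] at hk
    rw [if_pos ⟨by omega, by omega⟩, Nat.add_sub_cancel_left, zsmul_eq_mul, pow_add]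
    ring

/-- Upper bound for the resultant of two integer polynomials in terms of their heights and their
values at a point. -/
lemma abs_resultant_le {P Q : ℤ[X]} {ξ t : ℝ} (hd : 0 < P.natDegree + Q.natDegree)
    (hP : |aeval ξ P| ≤ polyHeight P * t) (hQ : |aeval ξ Q| ≤ polyHeight Q * t) :
    |(P.resultant Q : ℝ)| ≤ (P.natDegree + Q.natDegree).factorial *
      (polyHeight Q ^ P.natDegree * polyHeight P ^ Q.natDegree *
        ((|ξ| + 1) ^ (P.natDegree + Q.natDegree) * t)) := by
  set m := P.natDegree with hm
  set k := Q.natDegree with hk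
  set S : Matrix (Fin (m + k)) (Fin (m + k)) ℝ := (Int.castRingHom ℝ).mapMatrix
    (sylvester P Q m k) with hS
  let r : Fin (m + k) := ⟨0, hd⟩
  let y : Fin (m + k) → ℝ := ∑ i : Fin (m + k), (ξ ^ (i : ℕ)) • S i
  have hH : ∀ R : ℤ[X], 0 ≤ polyHeight R := fun R => Nat.cast_nonneg _
  have hdet : (P.resultant Q : ℝ) = (S.updateRow r y).det := by
    rw [Matrix.det_updateRow_sum, hS, ← RingHom.map_det]
    simp only [r, pow_zero, one_smul, eq_intCast]
    rfl
  let h : Fin (m + k) → ℝ := fun j => j.addCases (fun _ => polyHeight Q) (fun _ => polyHeight P)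
  have hprod : ∏ j, h j = polyHeight Q ^ m * polyHeight P ^ k := by
    rw [Fin.prod_univ_add]
    simp [h]
  have hL : 1 ≤ |ξ| + 1 := by linarith [abs_nonneg ξ]
  have hshift : ∀ (R : ℤ[X]) (j : ℕ), j ≤ m + k → |aeval ξ R| ≤ polyHeight R * t →
      |ξ ^ j * aeval ξ R| ≤ polyHeight R * ((|ξ| + 1) ^ (m + k) * t) := by
    intro R j hj hR
    rw [abs_mul, abs_pow]
    calc |ξ| ^ j * |aeval ξ R| ≤ (|ξ| + 1) ^ (m + k) * (polyHeight R * t) := by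
          gcongr
          calc |ξ| ^ j ≤ (|ξ| + 1) ^ j := by gcongr; linarith
            _ ≤ _ := pow_le_pow_right₀ hL hj
      _ = _ := by ring
  rw [hdet, ← hprod]
  refine abs_det_le_of_row_small _ r h _ (fun i j hi => ?_) fun j => ?_
  · rw [Matrix.updateRow_ne hi, hS, RingHom.mapMatrix_apply, Matrix.map_apply]
    induction j using Fin.addCases with
    | left j =>
      simp only [h, sylvester, Matrix.of_apply, Fin.addCases_left]
      split_ifs
      · exact abs_coeff_le_polyHeight Q _
      · simpa using hH Q
    | right j =>
      simp only [h, sylvester, Matrix.of_apply, Fin.addCases_right]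
      split_ifs
      · exact abs_coeff_le_polyHeight P _
      · simpa using hH P
  · rw [Matrix.updateRow_self]
    have hy : y j = ∑ i : Fin (m + k), ξ ^ (i : ℕ) * ((sylvester P Q m k i j : ℤ) : ℝ) := by
      simp [y, hS, Finset.sum_apply]
    rw [hy]
    induction j using Fin.addCases with
    | left j =>
      simp only [h, sylvester, Matrix.of_apply, Fin.addCases_left]
      rw [sum_pow_mul_shift_coeff Q ξ hk.ge (by omega)]
      exact hshift Q j (by omega) hQ
    | right j =>
      simp only [h, sylvester, Matrix.of_apply, Fin.addCases_right]
      rw [sum_pow_mul_shift_coeff P ξ hm.ge (by omega)]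
      exact hshift P j (by omega) hP

lemma resultant_ne_zero_of_irreducible {P Q : ℤ[X]} (hP : Irreducible P) (hPd : P.natDegree ≠ 0)
    (h : ¬ P ∣ Q) : P.resultant Q ≠ 0 := by
  have hPp := hP.isPrimitive hPd
  have hcop : IsCoprime (P.map (Int.castRingHom ℚ)) (Q.map (Int.castRingHom ℚ)) :=
    (dvd_or_isCoprime _ _
      ((IsPrimitive.Int.irreducible_iff_irreducible_map_cast hPp).mp hP)).resolve_left
      fun hdvd => h ((IsPrimitive.Int.dvd_iff_map_cast_dvd_map_cast P Q hPp).mpr hdvd)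
  have := resultant_ne_zero _ _ hcop
  rw [natDegree_map_eq_of_injective Int.cast_injective,
    natDegree_map_eq_of_injective Int.cast_injective, resultant_map_map] at this
  exact fun h0 => this (by rw [h0, map_zero])

lemma one_le_of_resultant {n : ℕ} {ξ η X : ℝ} {P Q : ℤ[X]} (hP : Irreducible P)
    (hQ : Irreducible Q) (hPn : P.natDegree ≤ n) (hQn : Q.natDegree ≤ n)
    (hPd : P.natDegree ≠ 0) (hQd : Q.natDegree ≠ 0) (hdvd : ¬ P ∣ Q)
    (hPX : polyHeight P ≤ X) (hQX : polyHeight Q ≤ X)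
    (hPη : |aeval ξ P| ≤ η) (hQη : |aeval ξ Q| ≤ η) :
    1 ≤ (2 * n).factorial * (|ξ| + 1) ^ (2 * n) * (polyHeight P ^ (n - 1) * X ^ n * η) := by
  set a := polyHeight P with ha
  set b := polyHeight Q with hb
  have ha1 : 1 ≤ a := one_le_polyHeight hP.ne_zero
  have hb1 : 1 ≤ b := one_le_polyHeight hQ.ne_zero
  have hX1 : 1 ≤ X := ha1.trans hPX
  have hη : 0 ≤ η := (abs_nonneg _).trans hPη
  obtain ⟨d, hd⟩ := Nat.exists_eq_succ_of_ne_zero hPd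
  obtain ⟨e, he⟩ := Nat.exists_eq_succ_of_ne_zero hQd
  have hres : (1 : ℝ) ≤ |(P.resultant Q : ℝ)| := by
    have := Int.one_le_abs (resultant_ne_zero_of_irreducible hP hPd hdvd)
    exact_mod_cast this
  have hmain : ∀ t, 0 ≤ t → η ≤ a * t → η ≤ b * t →
      b ^ (d + 1) * a ^ (e + 1) * t ≤ a ^ (n - 1) * X ^ n * η →
      1 ≤ (2 * n).factorial * (|ξ| + 1) ^ (2 * n) * (a ^ (n - 1) * X ^ n * η) := by
    intro t ht h1 h2 h3
    refine hres.trans ((abs_resultant_le (by omega) (hPη.trans h1) (hQη.trans h2)).trans ?_)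
    rw [hd, he, ← ha, ← hb, Nat.succ_eq_add_one, Nat.succ_eq_add_one]
    calc _ = (d + 1 + (e + 1)).factorial * (|ξ| + 1) ^ (d + 1 + (e + 1)) *
          (b ^ (d + 1) * a ^ (e + 1) * t) := by ring
      _ ≤ _ := by
        gcongr
        · omega
        · linarith [abs_nonneg ξ]
        · omega
  have hpow : b ^ d * a ^ e * X ≤ a ^ (n - 1) * X ^ n := by
    calc b ^ d * a ^ e * X ≤ X ^ d * a ^ (n - 1) * X := by
          gcongr
          omega
      _ = a ^ (n - 1) * X ^ (d + 1) := by ring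
      _ ≤ a ^ (n - 1) * X ^ n := by
          gcongr
          omega
  rcases le_total a b with hab | hab
  · refine hmain (η / a) (by positivity) (by field_simp; rfl) ?_ ?_
    · rw [mul_div_assoc', le_div_iff₀ (by positivity), mul_comm]
      gcongr
    · calc b ^ (d + 1) * a ^ (e + 1) * (η / a) = b ^ d * a ^ e * b * η := by
            field_simp
            ring
        _ ≤ b ^ d * a ^ e * X * η := by gcongr
        _ ≤ _ := by gcongr
  · refine hmain (η / b) (by positivity) ?_ (by field_simp; rfl) ?_
    · rw [mul_div_assoc', le_div_iff₀ (by positivity), mul_comm]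
      gcongr
    · calc b ^ (d + 1) * a ^ (e + 1) * (η / b) = b ^ d * a ^ e * a * η := by
            field_simp
            ring
        _ ≤ b ^ d * a ^ e * X * η := by gcongr
        _ ≤ _ := by gcongr

/-- A root `α` of `Q` close to `ξ` makes `Q` small at `ξ`. -/
lemma abs_aeval_le_of_close_root {n : ℕ} {ξ α v X : ℝ} {Q : ℤ[X]} (hQ : Irreducible Q)
    (hα : aeval α Q = 0) (hQn : Q.natDegree ≤ n) (hX : 1 ≤ X) (hv : 0 ≤ v)
    (h : |ξ - α| ≤ (polyHeight Q)⁻¹ * X ^ (-v)) :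
    |aeval ξ Q| ≤ (n + 1) * (n * (|ξ| + 1) ^ n) * X ^ (-v) := by
  have hH := one_le_polyHeight hQ.ne_zero
  have h1 : |ξ - α| ≤ 1 := h.trans <| mul_le_one₀ (inv_le_one_of_one_le₀ hH)
    (by positivity) (Real.rpow_le_one_of_one_le_of_nonpos hX (by linarith))
  refine (abs_aeval_le_of_root hα hQn h1).trans ?_
  gcongr
  rwa [← div_eq_inv_mul, le_div_iff₀ (by positivity), mul_comm] at h

lemma natDegree_pos_of_root {α : ℝ} {Q : ℤ[X]} (hQ : Q ≠ 0) (hα : aeval α Q = 0) :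
    Q.natDegree ≠ 0 := by
  intro h
  have := one_le_abs_aeval_of_natDegree_eq_zero α hQ h
  rw [hα, abs_zero] at this
  linarith

/-- The real number `v` is admissible in the definition of the uniform exponent. -/
def UniformStarApprox (n : ℕ) (ξ v : ℝ) : Prop :=
  ∀ᶠ H : ℝ in atTop, ∃ α : ℝ, ∃ P : Polynomial ℤ, Irreducible P ∧
    Polynomial.aeval α P = 0 ∧ P.natDegree ≤ n ∧ polyHeight P ≤ H ∧
    0 < |ξ - α| ∧ |ξ - α| ≤ (polyHeight P)⁻¹ * H ^ (-v)

lemma UniformStarApprox.mono {n : ℕ} {ξ v v' : ℝ} (h : UniformStarApprox n ξ v') (hv : v ≤ v') :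
    UniformStarApprox n ξ v := by
  filter_upwards [h, eventually_ge_atTop 1] with H ⟨α, P, h1, h2, h3, h4, h5, h6⟩ hH
  refine ⟨α, P, h1, h2, h3, h4, h5, h6.trans ?_⟩
  have := one_le_polyHeight h1.ne_zero
  gcongr

lemma uniformStarApprox_of_lt {n : ℕ} {ξ v : ℝ} (h : (v : EReal) < whStarExp n ξ) :
    UniformStarApprox n ξ v := by
  obtain ⟨_, ⟨v', rfl, h'⟩, hvv'⟩ := lt_sSup_iff.mp h
  exact UniformStarApprox.mono h' (EReal.coe_lt_coe_iff.mp hvv').le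

lemma le_add_of_uniformStarApprox {n : ℕ} (hn : 1 ≤ n) {ξ v w : ℝ} (hξ : Transcendental ℚ ξ)
    (hv0 : 0 < v) (hvw : v ≤ w) (hv : UniformStarApprox n ξ v) (hw : (w : EReal) < wExp n ξ) :
    v ≤ n + (n - 1) * (v / w) := by
  by_contra! hcon
  have hw0 : 0 < w := hv0.trans_le hvw
  set γ : ℝ := v - (n + (n - 1) * (v / w)) with hγ
  have hγ0 : 0 < γ := by linarith
  set c : ℝ := (n + 1) * (n * (|ξ| + 1) ^ n) with hc
  have hn1 : (1 : ℝ) ≤ n := by exact_mod_cast hn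
  have hc1 : 1 ≤ c := by
    have : (1 : ℝ) ≤ (|ξ| + 1) ^ n := one_le_pow₀ (by linarith [abs_nonneg ξ])
    exact one_le_mul_of_one_le_of_one_le (by linarith) (one_le_mul_of_one_le_of_one_le hn1 this)
  set K : ℝ := (2 * n).factorial * (|ξ| + 1) ^ (2 * n) with hK
  have hK0 : 0 < K := by positivity
  obtain ⟨X₀, hX₀⟩ := eventually_atTop.mp hv
  have hlim : Tendsto (fun x : ℝ => K * (2 * c) * x ^ (-γ)) atTop (nhds 0) := by
    simpa using (tendsto_rpow_neg_atTop hγ0).const_mul (K * (2 * c))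
  obtain ⟨X₁, hX₁, hX₁₀, hX₁1⟩ := ((hlim.eventually_lt_const one_pos).and
    ((eventually_ge_atTop X₀).and (eventually_ge_atTop 1))).exists
  obtain ⟨P, hP, hPn, hPw⟩ := exists_irreducible_abs_aeval_lt hw0.le hw
    (δ := min 1 (2 * c * X₁ ^ (-v))) (by positivity)
  set η := |aeval ξ P| with hη
  have hη0 : 0 < η := abs_pos.mpr (aeval_ne_zero_of_transcendental hξ hP.ne_zero)
  have hH := one_le_polyHeight hP.ne_zero
  have hHw : polyHeight P ^ (-w) ≤ 1 :=
    Real.rpow_le_one_of_one_le_of_nonpos hH (by linarith)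
  have hPd : P.natDegree ≠ 0 := by
    intro h
    have h1 := one_le_abs_aeval_of_natDegree_eq_zero ξ hP.ne_zero h
    have h2 := hPw.trans_le (mul_le_one₀ (min_le_left _ _) (by positivity) hHw)
    linarith
  set X : ℝ := (2 * c / η) ^ v⁻¹ with hX
  have hXv : X ^ v = 2 * c / η := Real.rpow_inv_rpow (by positivity) hv0.ne'
  have hXX₁ : X₁ ≤ X := by
    rw [hX, Real.le_rpow_inv_iff_of_pos (by positivity) (by positivity) hv0,
      le_div_iff₀ hη0]
    have h1 : η ≤ 2 * c * X₁ ^ (-v) := hPw.le.trans <|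
      (mul_le_mul (min_le_right _ _) hHw (by positivity) (by positivity)).trans_eq (mul_one _)
    rw [Real.rpow_neg (by positivity), ← div_eq_mul_inv, le_div_iff₀ (by positivity)] at h1
    linarith
  have hX1 : 1 ≤ X := hX₁1.trans hXX₁
  have hX0 : 0 < X := by linarith
  have hXnv : X ^ (-v) = η / (2 * c) := by rw [Real.rpow_neg hX0.le, hXv, inv_div]
  have hPX : polyHeight P ≤ X ^ (v / w) := by
    rw [div_eq_mul_inv, Real.rpow_mul hX0.le,
      Real.le_rpow_inv_iff_of_pos (by positivity) (by positivity) hw0, hXv, le_div_iff₀ hη0]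
    have h1 : η ≤ 1 * polyHeight P ^ (-w) := hPw.le.trans (by gcongr; exact min_le_left _ _)
    rw [one_mul, Real.rpow_neg (by positivity), ← one_div, le_div_iff₀ (by positivity)] at h1
    linarith
  obtain ⟨α, Q, hQ, hα, hQn, hQX, -, hdist⟩ := hX₀ X (hX₁₀.trans hXX₁)
  have hQη : |aeval ξ Q| ≤ η / 2 := by
    refine (abs_aeval_le_of_close_root hQ hα hQn hX1 hv0.le hdist).trans_eq ?_
    rw [hXnv, ← hc]
    field_simp
  have hdvd : ¬ P ∣ Q := by
    rintro ⟨u, rfl⟩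
    have hu := (hQ.isUnit_or_isUnit rfl).resolve_left hP.not_isUnit
    have h1 := one_le_abs_aeval_of_natDegree_eq_zero ξ hu.ne_zero (natDegree_eq_zero_of_isUnit hu)
    rw [map_mul, abs_mul, ← hη] at hQη
    nlinarith
  have hfin := one_le_of_resultant hP hQ hPn hQn hPd (natDegree_pos_of_root hQ.ne_zero hα) hdvd
    (hPX.trans (Real.rpow_le_self_of_one_le hX1 ((div_le_one hw0).mpr hvw))) hQX hη.ge
    (hQη.trans (by linarith))
  have hη' : η = 2 * c * X ^ (-v) := by rw [hXnv]; field_simp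
  have hbound : polyHeight P ^ (n - 1) * X ^ n * η ≤ 2 * c * X ^ (-γ) := by
    calc polyHeight P ^ (n - 1) * X ^ n * η ≤ (X ^ (v / w)) ^ (n - 1) * X ^ n * η := by gcongr
      _ = 2 * c * X ^ (-γ) := by
        rw [hη', ← Real.rpow_mul_natCast hX0.le, ← Real.rpow_natCast X n, Nat.cast_sub hn,
          ← Real.rpow_add hX0, mul_left_comm, ← Real.rpow_add hX0, hγ]
        congr 2
        push_cast
        ring
  have : K * (2 * c) * X ^ (-γ) ≤ K * (2 * c) * X₁ ^ (-γ) := by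
    gcongr 1
    exact Real.rpow_le_rpow_of_nonpos (by linarith) hXX₁ (by linarith)
  have : K * (polyHeight P ^ (n - 1) * X ^ n * η) ≤ K * (2 * c * X ^ (-γ)) := by gcongr
  linarith

lemma le_wExp_of_uniformStarApprox {n : ℕ} {ξ v u : ℝ} (hξ : Transcendental ℚ ξ)
    (hu : 0 ≤ u) (huv : u < v) (hv : UniformStarApprox n ξ v) : (u : EReal) ≤ wExp n ξ := by
  refine le_sSup ⟨u, rfl, fun hfin => ?_⟩
  set c : ℝ := (n + 1) * (n * (|ξ| + 1) ^ n) with hc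
  obtain ⟨μ, hμ0, hμ⟩ : ∃ μ : ℝ, 0 < μ ∧ ∀ P : ℤ[X], P.natDegree ≤ n ∧ 0 < |aeval ξ P| ∧
      |aeval ξ P| ≤ (polyHeight P) ^ (-u) → μ ≤ |aeval ξ P| := by
    rcases Set.eq_empty_or_nonempty {P : ℤ[X] | P.natDegree ≤ n ∧ 0 < |aeval ξ P| ∧
      |aeval ξ P| ≤ (polyHeight P) ^ (-u)} with he | hne
    · exact ⟨1, one_pos, fun P hP => absurd (show P ∈ (∅ : Set ℤ[X]) from he ▸ hP) (by simp)⟩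
    · obtain ⟨P₀, hP₀, hmin⟩ := Set.exists_min_image _ (fun P => |aeval ξ P|) hfin hne
      exact ⟨_, hP₀.2.1, fun P hP => hmin P hP⟩
  have hlim1 : Tendsto (fun x : ℝ => c * x ^ (-v)) atTop (nhds 0) := by
    simpa using (tendsto_rpow_neg_atTop (hu.trans_lt huv)).const_mul c
  have hlim2 : Tendsto (fun x : ℝ => c * x ^ (-(v - u))) atTop (nhds 0) := by
    simpa using (tendsto_rpow_neg_atTop (sub_pos.mpr huv)).const_mul c
  obtain ⟨X, ⟨α, Q, hQ, hα, hQn, hQX, -, hdist⟩, h1, h2, hX1⟩ :=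
    (hv.and ((hlim1.eventually_lt_const hμ0).and
      ((hlim2.eventually_lt_const one_pos).and (eventually_ge_atTop 1)))).exists
  have hX0 : 0 < X := by linarith
  have hQv := abs_aeval_le_of_close_root hQ hα hQn hX1 (hu.trans huv.le) hdist
  have hQu : |aeval ξ Q| ≤ polyHeight Q ^ (-u) := by
    refine hQv.trans (le_trans ?_ (Real.rpow_le_rpow_of_nonpos
      (by linarith [one_le_polyHeight hQ.ne_zero]) hQX (by linarith)))
    rw [show -v = -(v - u) + -u by ring, Real.rpow_add hX0, ← mul_assoc]
    exact mul_le_of_le_one_left (by positivity) h2.le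
  have := hμ Q ⟨hQn, abs_pos.mpr (aeval_ne_zero_of_transcendental hξ hQ.ne_zero), hQu⟩
  linarith

lemma wExp_nonneg {n : ℕ} (hn : 1 ≤ n) {ξ : ℝ} (hξ : Transcendental ℚ ξ) : 0 ≤ wExp n ξ := by
  refine le_sSup ⟨0, rfl, ?_⟩
  let f : ℕ → ℤ[X] := fun q => C ((q : ℤ) + 1) * X + C (-⌊((q : ℝ) + 1) * ξ⌋)
  have hf : Function.Injective f := by
    intro a b hab
    have := congrArg (fun P => coeff P 1) hab
    simp only [f, coeff_add, coeff_C_mul, coeff_X_one, coeff_C_succ] at this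
    omega
  refine Set.infinite_of_injective_forall_mem hf fun q => ⟨natDegree_linear_le.trans hn, ?_, ?_⟩
  · refine abs_pos.mpr (aeval_ne_zero_of_transcendental hξ fun h => ?_)
    have := congrArg (fun P => coeff P 1) h
    simp only [f, coeff_add, coeff_C_mul, coeff_X_one, coeff_C_succ, coeff_zero] at this
    omega
  · have : aeval ξ (f q) = Int.fract (((q : ℝ) + 1) * ξ) := by
      simp only [f, map_add (aeval ξ), map_mul (aeval ξ), aeval_C, aeval_X, algebraMap_int_eq]
      simp only [eq_intCast, Int.fract]
      push_cast
      ring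
    rw [this, neg_zero, Real.rpow_zero, abs_of_nonneg (Int.fract_nonneg _)]
    exact (Int.fract_lt_one _).le

lemma whStarExp_nonneg {n : ℕ} (hn : 1 ≤ n) {ξ : ℝ} (hξ : Transcendental ℚ ξ) :
    0 ≤ whStarExp n ξ := by
  have key : ∀ w : ℝ, w < 0 → (w : EReal) ≤ whStarExp n ξ := by
    intro w hw
    refine le_sSup ⟨w, rfl, ?_⟩
    have hlim : Tendsto (fun H : ℝ => (polyHeight (X - C ⌊ξ⌋))⁻¹ * H ^ (-w)) atTop atTop :=
      (tendsto_rpow_atTop (by linarith)).const_mul_atTop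
        (inv_pos.mpr (by linarith [one_le_polyHeight (X_sub_C_ne_zero ⌊ξ⌋)]))
    filter_upwards [eventually_ge_atTop (polyHeight (X - C ⌊ξ⌋)),
      hlim.eventually_ge_atTop |ξ - ⌊ξ⌋|] with H hH hH2
    refine ⟨⌊ξ⌋, X - C ⌊ξ⌋, irreducible_X_sub_C _, by simp,
      (natDegree_X_sub_C _).trans_le hn, hH, ?_, hH2⟩
    have := aeval_ne_zero_of_transcendental hξ (X_sub_C_ne_zero ⌊ξ⌋)
    exact abs_pos.mpr (by simpa using this)
  refine le_of_forall_lt fun x hx => ?_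
  obtain ⟨y, hxy, hy⟩ := EReal.lt_iff_exists_real_btwn.mp hx
  exact hxy.trans_le (key y (by exact_mod_cast hy))

lemma whStarExp_le_wExp {n : ℕ} (hn : 1 ≤ n) {ξ : ℝ} (hξ : Transcendental ℚ ξ) :
    whStarExp n ξ ≤ wExp n ξ := by
  refine le_of_forall_lt fun x hx => ?_
  obtain ⟨u, hxu, hu⟩ := EReal.lt_iff_exists_real_btwn.mp hx
  rcases lt_or_ge u 0 with h0 | h0
  · exact (hxu.trans (by exact_mod_cast h0)).trans_le (wExp_nonneg hn hξ)
  obtain ⟨v, huv, hv⟩ := EReal.lt_iff_exists_real_btwn.mp hu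
  exact hxu.trans_le (le_wExp_of_uniformStarApprox hξ h0 (by exact_mod_cast huv)
    (uniformStarApprox_of_lt hv))

theorem stmt18 (n : ℕ) (hn : 1 ≤ n) (ξ : ℝ) (hξ : Transcendental ℚ ξ) :
    whStarExp n ξ ≤ (n : EReal) + ((n : EReal) - 1) * whStarExp n ξ / wExp n ξ := by
  have hV0 := whStarExp_nonneg hn hξ
  have hW0 := wExp_nonneg hn hξ
  have hVW := whStarExp_le_wExp hn hξ
  have hn1 : (1 : ℝ) ≤ n := by exact_mod_cast hn
  have hn1' : (n : EReal) - 1 = ((n - 1 : ℝ) : EReal) := by simp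
  have hn0 : (0 : EReal) ≤ (n : EReal) - 1 := by
    rw [hn1']
    exact_mod_cast sub_nonneg.mpr hn1
  rcases le_or_gt (whStarExp n ξ) n with hle | hgt
  · exact hle.trans (le_add_of_nonneg_right (EReal.div_nonneg (mul_nonneg hn0 hV0) hW0))
  rcases eq_or_ne (wExp n ξ) ⊤ with hT | hT
  · exfalso
    obtain ⟨v, hnv, hv⟩ := EReal.lt_iff_exists_real_btwn.mp hgt
    have hnv' : (n : ℝ) < v := by exact_mod_cast hnv
    have hvn : 0 < v - n := by linarith
    have hm : 0 ≤ ((n : ℝ) - 1) * v / (v - n) :=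
      div_nonneg (mul_nonneg (by linarith) (by linarith)) hvn.le
    have hle := le_add_of_uniformStarApprox hn hξ (v := v)
      (w := v + (n - 1) * v / (v - n)) (by linarith) (by linarith)
      (uniformStarApprox_of_lt hv) (hT ▸ EReal.coe_lt_top _)
    set w := v + (n - 1) * v / (v - n) with hw
    have hw0 : 0 < w := by linarith
    have h1 : (v - n) * w ≤ (n - 1) * v := by
      rw [mul_div_assoc', ← sub_le_iff_le_add', le_div_iff₀ hw0] at hle
      exact hle
    have h2 : (v - n) * w = (v - n) * v + (n - 1) * v := by
      rw [hw]
      field_simp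
    nlinarith
  obtain ⟨W, hW⟩ : ∃ W : ℝ, wExp n ξ = W :=
    ⟨_, (EReal.coe_toReal hT (ne_bot_of_le_ne_bot EReal.zero_ne_bot hW0)).symm⟩
  obtain ⟨V, hV⟩ : ∃ V : ℝ, whStarExp n ξ = V :=
    ⟨_, (EReal.coe_toReal (ne_top_of_le_ne_top hT hVW)
      (ne_bot_of_le_ne_bot EReal.zero_ne_bot hV0)).symm⟩
  rw [hW, hV] at hVW
  have hVW' : V ≤ W := by exact_mod_cast hVW
  have hVn : (n : ℝ) < V := by rw [hV] at hgt; exact_mod_cast hgt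
  have hVpos : 0 < V := by linarith
  have hWpos : 0 < W := by linarith
  suffices h : V ≤ n + (n - 1) * V / W by
    rw [hV, hW, hn1', ← EReal.coe_mul, ← EReal.coe_div]
    exact_mod_cast h
  refine le_of_forall_lt_imp_le_of_dense fun y hy => ?_
  rcases le_or_gt y 0 with hy0 | hy0
  · exact hy0.trans (by have : 0 ≤ (n : ℝ) - 1 := by linarith
                        positivity)
  have ht0 : 0 < y / V := by positivity
  have ht1 : y / V < 1 := (div_lt_one hVpos).mpr hy
  have h := le_add_of_uniformStarApprox hn hξ (v := y) (w := y / V * W) hy0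
    (by rw [div_mul_eq_mul_div, le_div_iff₀ hVpos]; gcongr)
    (uniformStarApprox_of_lt (by rw [hV]; exact_mod_cast hy))
    (by rw [hW]; exact_mod_cast mul_lt_of_lt_one_left hWpos ht1)
  rwa [← div_div, div_div_cancel₀ hy0.ne', mul_div_assoc'] at h
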